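/- Fix real constants c ∈ (0,1), an integer N ≥ 1, and define H(z) = (∫₀¹ u² (1−cu)² (1−u)^N (1−zu)^N du) / (∫₀¹ u³ (1−cu)² (1−u)^N (1−zu)^N du) for z ≤ 1. Then H is convex on (−∞, 1]. -/

import Mathlib

open Set MeasureTheory intervalIntegral

/-- The integral of `u ^ i * (1 - c * u) ^ 2 * (1 - u) ^ N * (1 - z * u) ^ k` over `[0, 1]`. -/
noncomputable def betaMoment (c : ℝ) (N i k : ℕ) (z : ℝ) : ℝ :=
  ∫ u in (0:ℝ)..1, u ^ i * (1 - c * u) ^ 2 * (1 - u) ^ N * (1 - z * u) ^ k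

theorem integral_linear_combination_two {f g : ℝ → ℝ} (hf : Continuous f) (hg : Continuous g)
    (a b : ℝ) :
    ∫ u in (0:ℝ)..1, (a * f u + b * g u) =
      a * (∫ u in (0:ℝ)..1, f u) + b * ∫ u in (0:ℝ)..1, g u := by
  rw [integral_add ((by fun_prop : Continuous fun u => a * f u).intervalIntegrable _ _)
    ((by fun_prop : Continuous fun u => b * g u).intervalIntegrable _ _),
    intervalIntegral.integral_const_mul, intervalIntegral.integral_const_mul]

theorem integral_linear_combination_three {f g h : ℝ → ℝ} (hf : Continuous f)
    (hg : Continuous g) (hh : Continuous h) (a b d : ℝ) :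
    ∫ u in (0:ℝ)..1, (a * f u + b * g u + d * h u) =
      a * (∫ u in (0:ℝ)..1, f u) + b * (∫ u in (0:ℝ)..1, g u) + d * ∫ u in (0:ℝ)..1, h u := by
  have h1 := integral_linear_combination_two (f := fun u => a * f u + b * g u) (g := h)
    (by fun_prop) hh 1 d
  rw [integral_linear_combination_two hf hg] at h1
  simpa using h1

theorem integral_deriv_eq_zero_of_boundary {Φ Φ' : ℝ → ℝ} (h : ∀ u, HasDerivAt Φ (Φ' u) u)
    (hc : Continuous Φ') (h0 : Φ 0 = 0) (h1 : Φ 1 = 0) : ∫ u in (0:ℝ)..1, Φ' u = 0 := by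
  rw [integral_eq_sub_of_hasDerivAt (fun u _ => h u) (hc.intervalIntegrable _ _), h0, h1, sub_zero]

theorem hasDerivAt_integral_mul_pow {g : ℝ → ℝ} (hg : Continuous g) (k : ℕ) (z : ℝ) :
    HasDerivAt (fun z => ∫ u in (0:ℝ)..1, g u * (1 - z * u) ^ k)
      (-k * ∫ u in (0:ℝ)..1, u * g u * (1 - z * u) ^ (k - 1)) z := by
  have hF' : Continuous fun p : ℝ × ℝ => g p.2 * (k * (1 - p.1 * p.2) ^ (k - 1) * (-p.2)) := by
    fun_prop
  obtain ⟨C, hC⟩ := ((isCompact_Icc (a := z - 1) (b := z + 1)).prod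
    (isCompact_Icc (a := (0:ℝ)) (b := 1))).exists_bound_of_continuousOn hF'.continuousOn
  have key := (hasDerivAt_integral_of_dominated_loc_of_deriv_le (μ := volume) (a := 0) (b := 1)
    (F := fun z u => g u * (1 - z * u) ^ k)
    (F' := fun z u => g u * (k * (1 - z * u) ^ (k - 1) * (-u))) (x₀ := z)
    (s := Icc (z - 1) (z + 1)) (bound := fun _ => C)
    (Icc_mem_nhds (by linarith) (by linarith))
    (Filter.Eventually.of_forall fun x =>
      (by fun_prop : Continuous fun u => g u * (1 - x * u) ^ k).aestronglyMeasurable)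
    ((by fun_prop : Continuous fun u => g u * (1 - z * u) ^ k).intervalIntegrable _ _)
    (by fun_prop : Continuous fun u =>
      g u * (k * (1 - z * u) ^ (k - 1) * (-u))).aestronglyMeasurable
    (Filter.Eventually.of_forall fun t ht x hx => hC (x, t) ⟨hx, by
      rw [uIoc_of_le zero_le_one] at ht
      exact Ioc_subset_Icc_self ht⟩)
    intervalIntegrable_const
    (Filter.Eventually.of_forall fun t _ x _ => by
      have h1 : HasDerivAt (fun x : ℝ => 1 - x * t) (-t) x := by
        simpa using ((hasDerivAt_id x).mul_const t).const_sub 1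
      exact (h1.pow k).const_mul (g t))).2
  refine key.congr_deriv ?_
  rw [← intervalIntegral.integral_const_mul]
  exact integral_congr fun u _ => by ring

theorem hasDerivAt_betaMoment (c : ℝ) (N i k : ℕ) (z : ℝ) :
    HasDerivAt (betaMoment c N i k) (-k * betaMoment c N (i + 1) (k - 1) z) z := by
  refine (hasDerivAt_integral_mul_pow
    (g := fun u => u ^ i * (1 - c * u) ^ 2 * (1 - u) ^ N) (by fun_prop) k z).congr_deriv ?_
  exact congrArg _ (integral_congr fun u _ => by ring)

theorem one_sub_mul_pos {t u : ℝ} (ht : t ≤ 1) (hu : u ∈ Ioo (0:ℝ) 1) : 0 < 1 - t * u := by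
  nlinarith [mul_le_mul_of_nonneg_right ht hu.1.le, hu.2]

theorem one_sub_mul_nonneg {t u : ℝ} (ht : t ≤ 1) (hu : u ∈ Icc (0:ℝ) 1) : 0 ≤ 1 - t * u := by
  nlinarith [mul_le_mul_of_nonneg_right ht hu.1, hu.2]

theorem betaMoment_pos {c z : ℝ} (hc : c ≤ 1) (hz : z ≤ 1) (N i k : ℕ) :
    0 < betaMoment c N i k z := by
  refine intervalIntegral_pos_of_pos_on (Continuous.intervalIntegrable (by fun_prop) _ _)
    (fun u hu => ?_) zero_lt_one
  have h1 := one_sub_mul_pos hc hu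
  have h2 := one_sub_mul_pos hz hu
  have h3 : 0 < 1 - u := by linarith [hu.2]
  have h4 := hu.1
  positivity

theorem betaMoment_succ_le {c z : ℝ} (hc : c ≤ 1) (hz : z ≤ 1) (N i k : ℕ) :
    betaMoment c N (i + 1) k z ≤ betaMoment c N i k z := by
  refine integral_mono_on zero_le_one (Continuous.intervalIntegrable (by fun_prop) _ _)
    (Continuous.intervalIntegrable (by fun_prop) _ _) fun u hu => ?_
  have h1 := one_sub_mul_nonneg hc hu
  have h2 := one_sub_mul_nonneg hz hu
  have h3 : 0 ≤ 1 - u := by linarith [hu.2]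
  have h4 := hu.1
  have : u ^ (i + 1) ≤ u ^ i := pow_le_pow_of_le_one h4 hu.2 (Nat.le_succ i)
  gcongr

/-- The Cauchy–Schwarz inequality for the moments of a weight, shifted by a linear factor. -/
theorem integral_mul_linear_correlation {v : ℝ → ℝ} (hv : Continuous v)
    (h0 : ∀ u ∈ Icc (0:ℝ) 1, 0 ≤ v u) (t : ℝ) :
    (∫ u in (0:ℝ)..1, u * v u * (1 - t * u)) * (∫ u in (0:ℝ)..1, u * v u) ≤
      (∫ u in (0:ℝ)..1, v u * (1 - t * u)) * ∫ u in (0:ℝ)..1, u ^ 2 * v u := by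
  have e1 : ∫ u in (0:ℝ)..1, u * v u * (1 - t * u) =
      1 * (∫ u in (0:ℝ)..1, u * v u) + -t * ∫ u in (0:ℝ)..1, u ^ 2 * v u := by
    rw [← integral_linear_combination_two (by fun_prop) (by fun_prop)]
    exact integral_congr fun u _ => by ring
  have e2 : ∫ u in (0:ℝ)..1, v u * (1 - t * u) =
      1 * (∫ u in (0:ℝ)..1, v u) + -t * ∫ u in (0:ℝ)..1, u * v u := by
    rw [← integral_linear_combination_two (by fun_prop) (by fun_prop)]
    exact integral_congr fun u _ => by ring
  have hq : ∀ m : ℝ, 0 ≤ (∫ u in (0:ℝ)..1, v u) * (m * m) +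
      (-2 * ∫ u in (0:ℝ)..1, u * v u) * m + ∫ u in (0:ℝ)..1, u ^ 2 * v u := by
    intro m
    have h := integral_nonneg (μ := volume) zero_le_one
      (f := fun u => v u * (u - m) ^ 2) fun u hu => mul_nonneg (h0 u hu) (sq_nonneg _)
    have e := integral_linear_combination_three hv (by fun_prop : Continuous fun u => u * v u)
      (by fun_prop : Continuous fun u => u ^ 2 * v u) (m * m) (-2 * m) 1
    have e3 : ∫ u in (0:ℝ)..1, v u * (u - m) ^ 2 =
        ∫ u in (0:ℝ)..1, (m * m * v u + -2 * m * (u * v u) + 1 * (u ^ 2 * v u)) :=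
      integral_congr fun u _ => by ring
    rw [e3, e] at h
    linarith
  have hd := discrim_le_zero hq
  rw [discrim] at hd
  rw [e1, e2]
  nlinarith

theorem hasDerivAt_pow_mul_weight (c : ℝ) (n i : ℕ) (u : ℝ) :
    HasDerivAt (fun u : ℝ => u ^ (i + 1) * (1 - c * u) ^ 2 * (1 - u) ^ (n + 1))
      (u ^ i * (1 - c * u) * (1 - u) ^ n *
        ((i + 1) * (1 - c * u) * (1 - u) - 2 * c * u * (1 - u) - (n + 1) * u * (1 - c * u))) u := by
  have h1 : HasDerivAt (fun u : ℝ => 1 - c * u) (-c) u := by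
    simpa using ((hasDerivAt_id u).const_mul c).const_sub 1
  have h2 : HasDerivAt (fun u : ℝ => 1 - u) (-1) u := (hasDerivAt_id u).const_sub 1
  refine (((hasDerivAt_pow (i + 1) u).mul (h1.pow 2)).mul (h2.pow (n + 1))).congr_deriv ?_
  simp
  ring

theorem hasDerivAt_one_sub_mul_pow (z : ℝ) (k : ℕ) (u : ℝ) :
    HasDerivAt (fun u : ℝ => (1 - z * u) ^ (k + 1)) (-((k + 1) * z * (1 - z * u) ^ k)) u := by
  have h1 : HasDerivAt (fun u : ℝ => 1 - z * u) (-z) u := by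
    simpa using ((hasDerivAt_id u).const_mul z).const_sub 1
  refine (h1.pow (k + 1)).congr_deriv ?_
  simp
  ring

/-- Integration by parts for `betaMoment`. -/
theorem betaMoment_integration_by_parts (c z : ℝ) (n i k : ℕ) :
    (k + 1) * z * betaMoment c (n + 1) (i + 1) k z =
      (i + 1) * betaMoment c (n + 1) i (k + 1) z -
      (2 * c * (∫ u in (0:ℝ)..1,
          u ^ (i + 1) * ((1 - c * u) * (1 - u) ^ (n + 1) * (1 - z * u) ^ (k + 1))) +
        (n + 1) * ∫ u in (0:ℝ)..1,
          u ^ (i + 1) * ((1 - c * u) ^ 2 * (1 - u) ^ n * (1 - z * u) ^ (k + 1))) := by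
  have h := integral_deriv_eq_zero_of_boundary
    (fun u => (hasDerivAt_pow_mul_weight c n i u).mul (hasDerivAt_one_sub_mul_pow z k u))
    (by fun_prop) (by simp) (by simp)
  have e := integral_linear_combination_two
    (f := fun u => u ^ (i + 1) * (1 - c * u) ^ 2 * (1 - u) ^ (n + 1) * (1 - z * u) ^ k)
    (g := fun u => (i + 1) * (u ^ i * (1 - c * u) ^ 2 * (1 - u) ^ (n + 1) * (1 - z * u) ^ (k + 1))
      + -(2 * c) * (u ^ (i + 1) * ((1 - c * u) * (1 - u) ^ (n + 1) * (1 - z * u) ^ (k + 1)))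
      + -(n + 1) * (u ^ (i + 1) * ((1 - c * u) ^ 2 * (1 - u) ^ n * (1 - z * u) ^ (k + 1))))
    (by fun_prop) (by fun_prop) (-((k + 1) * z)) 1
  rw [integral_linear_combination_three (by fun_prop) (by fun_prop) (by fun_prop)] at e
  rw [integral_congr (g := fun u =>
    u ^ i * (1 - c * u) * (1 - u) ^ n *
        ((i + 1) * (1 - c * u) * (1 - u) - 2 * c * u * (1 - u) - (n + 1) * u * (1 - c * u)) *
      (1 - z * u) ^ (k + 1) + u ^ (i + 1) * (1 - c * u) ^ 2 * (1 - u) ^ (n + 1) *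
        -((k + 1) * z * (1 - z * u) ^ k)) (fun u _ => by ring), h] at e
  simp only [betaMoment]
  linarith

/-- The cubic whose sign pattern controls the convexity of the ratio of moments. -/
def tangentCubic (c : ℝ) (n : ℕ) (α β u : ℝ) : ℝ :=
  ((n + 2) * (1 - α * u) - α * u) * (1 - c * u) * (1 - u) +
    (1 - β - α * u) *
      (3 * (1 - c * u) * (1 - u) - 2 * c * u * (1 - u) - (n + 1) * u * (1 - c * u))

theorem betaMoment_sub_line_mul (c : ℝ) (n : ℕ) (α β z : ℝ) :
    (n + 2) * (betaMoment c (n + 1) 2 (n + 1) z -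
      (α + β * z) * betaMoment c (n + 1) 3 (n + 1) z) =
    ∫ u in (0:ℝ)..1, u ^ 2 * (1 - c * u) * (1 - u) ^ n * tangentCubic c n α β u *
      (1 - z * u) ^ (n + 2) := by
  have hl : ∀ u : ℝ, HasDerivAt (fun u : ℝ => α * u - (1 - β)) α u := fun u => by
    simpa using ((hasDerivAt_id u).const_mul α).sub_const (1 - β)
  have h := integral_deriv_eq_zero_of_boundary
    (fun u : ℝ => (hl u).mul ((hasDerivAt_pow_mul_weight c n 2 u).mul
      (hasDerivAt_one_sub_mul_pow z (n + 1) u)))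
    (by fun_prop) (by simp) (by simp)
  have e := integral_linear_combination_three
    (f := fun u => u ^ 2 * (1 - c * u) ^ 2 * (1 - u) ^ (n + 1) * (1 - z * u) ^ (n + 1))
    (g := fun u => u ^ 3 * (1 - c * u) ^ 2 * (1 - u) ^ (n + 1) * (1 - z * u) ^ (n + 1))
    (h := fun u => u ^ 2 * (1 - c * u) * (1 - u) ^ n * tangentCubic c n α β u *
      (1 - z * u) ^ (n + 2))
    (by fun_prop) (by fun_prop) (by unfold tangentCubic; fun_prop)
    (n + 2) (-((n + 2) * (α + β * z))) (-1)
  have e' : ∫ u in (0:ℝ)..1,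
      ((n + 2) * (u ^ 2 * (1 - c * u) ^ 2 * (1 - u) ^ (n + 1) * (1 - z * u) ^ (n + 1)) +
      -((n + 2) * (α + β * z)) *
        (u ^ 3 * (1 - c * u) ^ 2 * (1 - u) ^ (n + 1) * (1 - z * u) ^ (n + 1)) +
      -1 * (u ^ 2 * (1 - c * u) * (1 - u) ^ n * tangentCubic c n α β u *
        (1 - z * u) ^ (n + 2))) = 0 := by
    refine (integral_congr fun u _ => ?_).trans h
    simp only [tangentCubic, Pi.mul_apply]
    push_cast
    ring
  simp only [betaMoment]
  linarith

theorem tangentCubic_nonpos_of_between {c : ℝ} (hc0 : 0 < c) (hc1 : c < 1) {n : ℕ} {α β : ℝ}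
    (hα : 0 ≤ α) (hαβ : 1 ≤ α + β) {x y w : ℝ} (hxy : x < y) (hyw : y < w) (hw : w ≤ 1)
    (hx : tangentCubic c n α β x < 0) (hz : tangentCubic c n α β w < 0) :
    tangentCubic c n α β y ≤ 0 := by
  have h1 : 0 ≤ tangentCubic c n α β 1 := by
    have : tangentCubic c n α β 1 = (n + 1) * (1 - c) * (α + β - 1) := by
      unfold tangentCubic; ring
    rw [this]
    have := sub_nonneg.2 hc1.le
    have := sub_nonneg.2 hαβ
    positivity
  have hw1 : w < 1 := lt_of_le_of_ne hw (by rintro rfl; linarith)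
  by_contra! hy
  have hid : tangentCubic c n α β 1 * ((y - x) * (w - y) * (w - x))
      - tangentCubic c n α β w * ((y - x) * (1 - x) * (1 - y))
      + tangentCubic c n α β y * ((w - x) * (1 - x) * (1 - w))
      - tangentCubic c n α β x * ((w - y) * (1 - y) * (1 - w)) =
      -(α * c * (2 * n + 9)) * ((y - x) * (w - x) * (1 - x) * (w - y) * (1 - y) * (1 - w)) := by
    unfold tangentCubic; ring
  have a1 : 0 < y - x := by linarith
  have a2 : 0 < w - y := by linarith
  have a3 : 0 < w - x := by linarith
  have a4 : 0 < 1 - w := by linarith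
  have a5 : 0 < 1 - y := by linarith
  have a6 : 0 < 1 - x := by linarith
  have b1 : 0 ≤ tangentCubic c n α β 1 * ((y - x) * (w - y) * (w - x)) := by positivity
  have b2 := mul_pos (neg_pos.2 hz) (by positivity : 0 < (y - x) * (1 - x) * (1 - y))
  have b3 : 0 < tangentCubic c n α β y * ((w - x) * (1 - x) * (1 - w)) := by positivity
  have b4 := mul_pos (neg_pos.2 hx) (by positivity : 0 < (w - y) * (1 - y) * (1 - w))
  have b5 : 0 ≤ (α * c * (2 * n + 9)) *
      ((y - x) * (w - x) * (1 - x) * (w - y) * (1 - y) * (1 - w)) := by positivity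
  linarith

/-- A function on `[0, 1]` that is nonpositive between any two points of negativity has the
sign pattern of a quadratic with two roots in `[0, 1]`. -/
theorem exists_quadratic_sign {f : ℝ → ℝ}
    (hf : ∀ x ∈ Icc (0:ℝ) 1, ∀ w ∈ Icc (0:ℝ) 1, ∀ y, x < y → y < w → f x < 0 → f w < 0 → f y ≤ 0) :
    ∃ r ∈ Icc (0:ℝ) 1, ∃ s ∈ Icc (0:ℝ) 1, ∀ u ∈ Icc (0:ℝ) 1, 0 ≤ f u * ((u - r) * (u - s)) := by
  set S := {u ∈ Icc (0:ℝ) 1 | f u < 0}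
  by_cases hne : S.Nonempty
  · have hb : BddBelow S := ⟨0, fun u hu => hu.1.1⟩
    have ha : BddAbove S := ⟨1, fun u hu => hu.1.2⟩
    obtain ⟨x₀, hx₀⟩ := hne
    have i1 := csInf_le hb hx₀
    have i2 := le_csSup ha hx₀
    have i3 : 0 ≤ sInf S := le_csInf ⟨x₀, hx₀⟩ fun u hu => hu.1.1
    have i4 : sSup S ≤ 1 := csSup_le ⟨x₀, hx₀⟩ fun u hu => hu.1.2
    refine ⟨sInf S, ⟨i3, by linarith⟩, sSup S, ⟨by linarith, i4⟩, fun u hu => ?_⟩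
    have pos_of_notMem : u ∉ S → 0 ≤ f u := fun h => by
      by_contra! h'
      exact h ⟨hu, h'⟩
    rcases lt_or_ge u (sInf S) with h | h
    · exact mul_nonneg (pos_of_notMem fun h' => absurd (csInf_le hb h') (not_le.2 h))
        (mul_nonneg_of_nonpos_of_nonpos (by linarith) (by linarith))
    rcases lt_or_ge (sSup S) u with h2 | h2
    · exact mul_nonneg (pos_of_notMem fun h' => absurd (le_csSup ha h') (not_le.2 h2))
        (mul_nonneg (by linarith) (by linarith))
    rcases h.eq_or_lt with h | h
    · simp [h]
    rcases h2.eq_or_lt with h2 | h2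
    · simp [h2]
    obtain ⟨x, hx, hxu⟩ := exists_lt_of_csInf_lt ⟨x₀, hx₀⟩ h
    obtain ⟨w, hw, huw⟩ := exists_lt_of_lt_csSup ⟨x₀, hx₀⟩ h2
    exact mul_nonneg_of_nonpos_of_nonpos (hf x hx.1 w hw.1 u hxu huw hx.2 hw.2)
      (mul_nonpos_of_nonneg_of_nonpos (by linarith) (by linarith))
  · refine ⟨0, by simp, 0, by simp, fun u hu => mul_nonneg ?_ (by nlinarith)⟩
    by_contra! h
    exact hne ⟨u, hu, h⟩

/-- If `f` has the sign pattern of a quadratic with roots in `[0, 1]` and is orthogonal to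
`(1 - z * u) ^ 2` and `u * (1 - z * u)`, then its second moment is nonnegative. -/
theorem integral_sq_mul_nonneg_of_orthogonal {v f : ℝ → ℝ} (hv : Continuous v)
    (hf : Continuous f) (hv0 : ∀ u ∈ Icc (0:ℝ) 1, 0 ≤ v u) {z : ℝ} (hz : z < 1)
    (hsign : ∃ r ∈ Icc (0:ℝ) 1, ∃ s ∈ Icc (0:ℝ) 1,
      ∀ u ∈ Icc (0:ℝ) 1, 0 ≤ f u * ((u - r) * (u - s)))
    (h0 : ∫ u in (0:ℝ)..1, v u * f u * (1 - z * u) ^ 2 = 0)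
    (h1 : ∫ u in (0:ℝ)..1, v u * f u * (u * (1 - z * u)) = 0) :
    0 ≤ ∫ u in (0:ℝ)..1, v u * f u * u ^ 2 := by
  obtain ⟨r, hr, s, hs, hrs⟩ := hsign
  have h := integral_nonneg (μ := volume) zero_le_one
    (f := fun u => v u * (f u * ((u - r) * (u - s))))
    fun u hu => mul_nonneg (hv0 u hu) (hrs u hu)
  have e := integral_linear_combination_three
    (f := fun u => v u * f u * (1 - z * u) ^ 2)
    (g := fun u => v u * f u * (u * (1 - z * u))) (h := fun u => v u * f u * u ^ 2)
    (by fun_prop) (by fun_prop) (by fun_prop)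
    (r * s) (-(r * (1 - s * z) + s * (1 - r * z))) ((1 - r * z) * (1 - s * z))
  rw [h0, h1, integral_congr (g := fun u => v u * (f u * ((u - r) * (u - s))))
    (fun u _ => by ring)] at e
  have pr : 0 < 1 - r * z := by nlinarith [hr.1, hr.2, mul_le_mul_of_nonneg_left hz.le hr.1]
  have ps : 0 < 1 - s * z := by nlinarith [hs.1, hs.2, mul_le_mul_of_nonneg_left hz.le hs.1]
  rw [e, mul_zero, mul_zero, zero_add, zero_add] at h
  exact nonneg_of_mul_nonneg_right h (mul_pos pr ps)

theorem betaMoment_wronskian_nonneg (c : ℝ) {z : ℝ} (hz : z ≤ 1) (n : ℕ) :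
    betaMoment c (n + 1) 3 (n + 1) z * betaMoment c (n + 1) 3 n z ≤
      betaMoment c (n + 1) 2 (n + 1) z * betaMoment c (n + 1) 4 n z := by
  have h := integral_mul_linear_correlation
    (v := fun u => u ^ 2 * (1 - c * u) ^ 2 * (1 - u) ^ (n + 1) * (1 - z * u) ^ n)
    (by fun_prop) (fun u hu => by
      have h2 := one_sub_mul_nonneg hz hu
      have h3 : 0 ≤ 1 - u := by linarith [hu.2]
      positivity) z
  convert h using 2 <;> exact integral_congr fun u _ => by ring

theorem betaMoment_tangent_intercept_nonneg {c z : ℝ} (hc0 : 0 ≤ c) (hc : c ≤ 1) (hz : z ≤ 1)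
    (n : ℕ) :
    (n + 1) * z * (betaMoment c (n + 1) 2 (n + 1) z * betaMoment c (n + 1) 4 n z -
      betaMoment c (n + 1) 3 (n + 1) z * betaMoment c (n + 1) 3 n z) ≤
      betaMoment c (n + 1) 2 (n + 1) z * betaMoment c (n + 1) 3 (n + 1) z := by
  have p3 := betaMoment_integration_by_parts c z n 2 n
  have p4 := betaMoment_integration_by_parts c z n 3 n
  have h1 := integral_mul_linear_correlation
    (v := fun u => u ^ 2 * ((1 - c * u) * (1 - u) ^ (n + 1) * (1 - z * u) ^ (n + 1)))
    (by fun_prop) (fun u hu => by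
      have h1 := one_sub_mul_nonneg hc hu
      have h2 := one_sub_mul_nonneg hz hu
      have h3 : 0 ≤ 1 - u := by linarith [hu.2]
      positivity) c
  have h2 := integral_mul_linear_correlation
    (v := fun u => u ^ 2 * ((1 - c * u) ^ 2 * (1 - u) ^ n * (1 - z * u) ^ (n + 1)))
    (by fun_prop) (fun u hu => by
      have h2 := one_sub_mul_nonneg hz hu
      have h3 : 0 ≤ 1 - u := by linarith [hu.2]
      positivity) 1
  set P := betaMoment c (n + 1) 2 (n + 1) z
  set Q := betaMoment c (n + 1) 3 (n + 1) z
  set A3 := ∫ u in (0:ℝ)..1, u ^ (2 + 1) * ((1 - c * u) * (1 - u) ^ (n + 1) * (1 - z * u) ^ (n + 1))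
  set A4 := ∫ u in (0:ℝ)..1, u ^ (3 + 1) * ((1 - c * u) * (1 - u) ^ (n + 1) * (1 - z * u) ^ (n + 1))
  set B3 := ∫ u in (0:ℝ)..1, u ^ (2 + 1) * ((1 - c * u) ^ 2 * (1 - u) ^ n * (1 - z * u) ^ (n + 1))
  set B4 := ∫ u in (0:ℝ)..1, u ^ (3 + 1) * ((1 - c * u) ^ 2 * (1 - u) ^ n * (1 - z * u) ^ (n + 1))
  have k1 : Q * A3 ≤ P * A4 := by
    convert h1 using 2 <;> exact integral_congr fun u _ => by ring
  have k2 : Q * B3 ≤ P * B4 := by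
    convert h2 using 2 <;> exact integral_congr fun u _ => by ring
  have l1 := mul_le_mul_of_nonneg_left k1 (by positivity : 0 ≤ 2 * c)
  have l2 := mul_le_mul_of_nonneg_left k2 (by positivity : (0:ℝ) ≤ n + 1)
  norm_num at p3 p4
  linear_combination P * p4 - Q * p3 + l1 + l2

/-- The second derivative of the difference between the numerator and a tangent line times the
denominator is nonnegative. -/
theorem betaMoment_tangent_second_deriv_nonneg {c z : ℝ} (hc0 : 0 < c) (hc1 : c < 1) (hz : z < 1)
    (n : ℕ) {α β : ℝ} (hα : 0 ≤ α) (hαβ : 1 ≤ α + β)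
    (h0 : betaMoment c (n + 1) 2 (n + 1) z - (α + β * z) * betaMoment c (n + 1) 3 (n + 1) z = 0)
    (h1 : -(n + 1) * betaMoment c (n + 1) 3 n z - (β * betaMoment c (n + 1) 3 (n + 1) z +
      (α + β * z) * (-(n + 1) * betaMoment c (n + 1) 4 n z)) = 0) :
    0 ≤ -(n + 1) * (-n * betaMoment c (n + 1) 4 (n - 1) z) -
      (β * (-(n + 1) * betaMoment c (n + 1) 4 n z) +
        (β * (-(n + 1) * betaMoment c (n + 1) 4 n z) +
        (α + β * z) * (-(n + 1) * (-n * betaMoment c (n + 1) 5 (n - 1) z)))) := by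
  have hG : Continuous fun u => u ^ 2 * (1 - c * u) * (1 - u) ^ n * tangentCubic c n α β u := by
    unfold tangentCubic; fun_prop
  have hn2 : (n + 2 : ℝ) ≠ 0 := by positivity
  have hM : ∀ i x, HasDerivAt (betaMoment c (n + 1) i (n + 1))
      (-(n + 1) * betaMoment c (n + 1) (i + 1) n x) x := fun i x => by
    simpa using hasDerivAt_betaMoment c (n + 1) i (n + 1) x
  have hline : ∀ x : ℝ, HasDerivAt (fun x => α + β * x) β x := fun x => by
    simpa using ((hasDerivAt_id x).const_mul β).const_add α
  have first : ∀ x : ℝ, -(n + 1) * betaMoment c (n + 1) 3 n x -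
      (β * betaMoment c (n + 1) 3 (n + 1) x +
        (α + β * x) * (-(n + 1) * betaMoment c (n + 1) 4 n x)) =
      -∫ u in (0:ℝ)..1, u * (u ^ 2 * (1 - c * u) * (1 - u) ^ n * tangentCubic c n α β u) *
        (1 - x * u) ^ (n + 1) := fun x => by
    have d1 := ((hM 2 x).sub ((hline x).mul (hM 3 x))).const_mul (n + 2 : ℝ)
    have d2 := hasDerivAt_integral_mul_pow hG (n + 2) x
    have := d1.unique (d2.congr_of_eventuallyEq
      (Filter.Eventually.of_forall (betaMoment_sub_line_mul c n α β)))
    refine mul_left_cancel₀ hn2 (this.trans ?_)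
    rw [mul_neg, ← neg_mul]
    push_cast
    rfl
  have second : -(n + 1) * (-n * betaMoment c (n + 1) 4 (n - 1) z) -
      (β * (-(n + 1) * betaMoment c (n + 1) 4 n z) +
        (β * (-(n + 1) * betaMoment c (n + 1) 4 n z) +
        (α + β * z) * (-(n + 1) * (-n * betaMoment c (n + 1) 5 (n - 1) z)))) =
      (n + 1) * ∫ u in (0:ℝ)..1,
        u * (u * (u ^ 2 * (1 - c * u) * (1 - u) ^ n * tangentCubic c n α β u)) *
        (1 - z * u) ^ n := by
    have d1 := ((hasDerivAt_betaMoment c (n + 1) 3 n z).const_mul (-(n + 1) : ℝ)).sub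
      (((hM 3 z).const_mul β).add
      ((hline z).mul ((hasDerivAt_betaMoment c (n + 1) 4 n z).const_mul (-(n + 1) : ℝ))))
    have d2 := (hasDerivAt_integral_mul_pow (continuous_id.mul hG) (n + 1) z).neg
    have := d1.unique (d2.congr_of_eventuallyEq (Filter.Eventually.of_forall first))
    refine this.trans ?_
    rw [← neg_mul, neg_neg]
    push_cast
    rfl
  have z0 := betaMoment_sub_line_mul c n α β z
  rw [h0, mul_zero] at z0
  have z1 := first z
  rw [h1, eq_comm, neg_eq_zero] at z1
  rw [second]
  refine mul_nonneg (by positivity) ?_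
  have key := integral_sq_mul_nonneg_of_orthogonal
    (v := fun u => u ^ 2 * (1 - c * u) * (1 - u) ^ n * (1 - z * u) ^ n)
    (f := tangentCubic c n α β) (by fun_prop) (by unfold tangentCubic; fun_prop)
    (fun u hu => by
      have h1 := one_sub_mul_nonneg hc1.le hu
      have h2 := one_sub_mul_nonneg hz.le hu
      have h3 : 0 ≤ 1 - u := by linarith [hu.2]
      positivity) hz
    (exists_quadratic_sign fun x _ w hw y hxy hyw hx hw' =>
      tangentCubic_nonpos_of_between hc0 hc1 hα hαβ hxy hyw hw.2 hx hw')
    ((integral_congr fun u _ => by ring).trans z0.symm)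
    ((integral_congr fun u _ => by ring).trans z1)
  refine key.trans_eq (integral_congr fun u _ => by ring)

/-- For `c ∈ (0,1)` and an integer `N ≥ 1`, the function
`H(z) = (∫₀¹ u²(1−cu)²(1−u)^N(1−zu)^N du) / (∫₀¹ u³(1−cu)²(1−u)^N(1−zu)^N du)`
is convex on `(−∞, 1]`. -/
theorem hypergeometric_ratio_convex (c : ℝ) (hc : c ∈ Set.Ioo (0 : ℝ) 1)
    (N : ℕ) (hN : 1 ≤ N) :
    ConvexOn ℝ (Set.Iic (1 : ℝ))
      (fun z : ℝ =>
        (∫ u in (0:ℝ)..1, u ^ 2 * (1 - c * u) ^ 2 * (1 - u) ^ N * (1 - z * u) ^ N) /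
        (∫ u in (0:ℝ)..1, u ^ 3 * (1 - c * u) ^ 2 * (1 - u) ^ N * (1 - z * u) ^ N)) := by
  obtain ⟨n, rfl⟩ := Nat.exists_eq_add_of_le' hN
  change ConvexOn ℝ (Iic 1) fun z =>
    betaMoment c (n + 1) 2 (n + 1) z / betaMoment c (n + 1) 3 (n + 1) z
  have hM : ∀ i x, HasDerivAt (betaMoment c (n + 1) i (n + 1))
      (-(n + 1) * betaMoment c (n + 1) (i + 1) n x) x := fun i x => by
    simpa using hasDerivAt_betaMoment c (n + 1) i (n + 1) x
  have hM' : ∀ i x, HasDerivAt (fun x => -(n + 1) * betaMoment c (n + 1) i n x)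
      (-(n + 1) * (-n * betaMoment c (n + 1) (i + 1) (n - 1) x)) x := fun i x =>
    (hasDerivAt_betaMoment c (n + 1) i n x).const_mul _
  have hQ : ∀ x ∈ Iic (1:ℝ), 0 < betaMoment c (n + 1) 3 (n + 1) x := fun x hx =>
    betaMoment_pos hc.2.le hx _ _ _
  refine convexOn_of_hasDerivWithinAt2_nonneg (convex_Iic 1)
    (fun x hx => ((hM 2 x).div (hM 3 x) (hQ x hx).ne').continuousAt.continuousWithinAt)
    (fun x hx => ((hM 2 x).div (hM 3 x)
      (hQ x (interior_subset hx)).ne').hasDerivWithinAt)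
    (fun x hx => ((((hM' 3 x).mul (hM 3 x)).sub ((hM 2 x).mul (hM' 4 x))).div
      ((hM 3 x).pow 2) (pow_pos (hQ x (interior_subset hx)) 2).ne').hasDerivWithinAt) ?_
  intro z hz
  rw [interior_Iic] at hz
  have hz : z < 1 := hz
  have hQz := hQ z hz.le
  have hPQ := betaMoment_succ_le hc.2.le hz.le (n + 1) 2 (n + 1)
  have hw := betaMoment_wronskian_nonneg c hz.le n
  have hi := betaMoment_tangent_intercept_nonneg hc.1.le hc.2.le hz.le n
  have key {α β : ℝ} := betaMoment_tangent_second_deriv_nonneg (α := α) (β := β) hc.1 hc.2 hz n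
  norm_num at hPQ
  simp only [Pi.sub_apply, Pi.mul_apply, Pi.pow_apply, Nat.reduceAdd]
  set P := betaMoment c (n + 1) 2 (n + 1) z
  set Q := betaMoment c (n + 1) 3 (n + 1) z
  set P₁ := betaMoment c (n + 1) 3 n z
  set Q₁ := betaMoment c (n + 1) 4 n z
  set P₂ := betaMoment c (n + 1) 4 (n - 1) z
  set Q₂ := betaMoment c (n + 1) 5 (n - 1) z
  set β := (n + 1) * (P * Q₁ - Q * P₁) / Q ^ 2 with hβ
  have hβ0 : 0 ≤ β := by
    have := sub_nonneg.2 hw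
    positivity
  have hα : 0 ≤ P / Q - β * z := by
    have : P / Q - β * z = (P * Q - (n + 1) * z * (P * Q₁ - Q * P₁)) / Q ^ 2 := by
      rw [hβ]; field_simp
    rw [this]
    exact div_nonneg (sub_nonneg.2 hi) (by positivity)
  have hH : 1 ≤ P / Q := (one_le_div hQz).2 hPQ
  have := key hα (by nlinarith : 1 ≤ P / Q - β * z + β) (by field_simp; ring) (by rw [hβ]; field_simp; ring)
  refine (div_nonneg this hQz.le).trans_eq ?_
  rw [hβ]
  simp
  field_simp
  ring
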